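/- arXiv:2006.02178 — 6 statements merged into one kernel-verified Lean document; each statement's English description precedes it below -/
import Mathlib

section
/- Let φ : A → B be a surjective morphism of augmented k-algebras and let 𝔞 = ker φ. Assume 𝔞 ⊆ I(A)² and 𝔞 = I(A)·𝔞 + 𝔞·I(A), where I(A)·𝔞 and 𝔞·I(A) denote the k-submodules of A spanned by the indicated products. Then 𝔞 ⊆ I(A)ⁿ for every n ≥ 1, and consequently φ induces a bijection A/I(A)ⁿ → B/I(B)ⁿ (of quotient k-modules) for every n ≥ 1; that is, φ is a paraequivalence. -/
/-- The augmentation ideal of an augmented `k`-algebra, as a `k`-submodule. -/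
def augIdeal {k A : Type*} [CommRing k] [Ring A] [Algebra k A] (ε : A →ₐ[k] k) :
    Submodule k A :=
  LinearMap.ker ε.toLinearMap

theorem map_augIdeal_of_surjective {k A B : Type*} [CommRing k] [Ring A] [Algebra k A] [Ring B]
    [Algebra k B] {εA : A →ₐ[k] k} {εB : B →ₐ[k] k} {φ : A →ₐ[k] B} (hφ : εB.comp φ = εA)
    (hsurj : Function.Surjective φ) :
    (augIdeal εA).map φ.toLinearMap = augIdeal εB := by
  subst hφ
  exact Submodule.map_comap_eq_of_surjective hsurj (augIdeal εB)

theorem ker_le_augIdeal {k A B : Type*} [CommRing k] [Ring A] [Algebra k A] [Ring B]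
    [Algebra k B] {εA : A →ₐ[k] k} {εB : B →ₐ[k] k} {φ : A →ₐ[k] B} (hφ : εB.comp φ = εA) :
    LinearMap.ker φ.toLinearMap ≤ augIdeal εA := by
  subst hφ
  exact LinearMap.ker_le_ker_comp φ.toLinearMap εB.toLinearMap

/-- A submodule of `I` contained in `I * N ⊔ N * I` lies in every positive power of `I`. -/
theorem Submodule.le_pow_of_le_mul_sup_mul {k A : Type*} [CommSemiring k] [Semiring A]
    [Algebra k A] {I N : Submodule k A} (hN : N ≤ I) (h : N ≤ I * N ⊔ N * I) {n : ℕ}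
    (hn : 1 ≤ n) : N ≤ I ^ n := by
  induction n, hn using Nat.le_induction with
  | base => simpa using hN
  | succ n _ ih =>
    refine h.trans (sup_le ?_ ?_)
    · rw [pow_succ']
      gcongr
    · rw [pow_succ]
      gcongr

/-- A surjective morphism of augmented algebras whose kernel `𝔞` satisfies `𝔞 ⊆ I(A)²` and
`𝔞 = I(A)𝔞 + 𝔞I(A)` has `𝔞 ⊆ I(A)ⁿ` for all `n ≥ 1`, and is a paraequivalence:
it induces bijections `A/I(A)ⁿ → B/I(B)ⁿ` for all `n ≥ 1`. -/
theorem two_acyclic_surjection_is_paraequivalence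
    {k A B : Type*} [CommRing k] [Ring A] [Algebra k A] [Ring B] [Algebra k B]
    (εA : A →ₐ[k] k) (εB : B →ₐ[k] k) (φ : A →ₐ[k] B) (hφ : εB.comp φ = εA)
    (hsurj : Function.Surjective φ)
    (h1 : LinearMap.ker φ.toLinearMap ≤ augIdeal εA ^ 2)
    (h2 : LinearMap.ker φ.toLinearMap =
      augIdeal εA * LinearMap.ker φ.toLinearMap ⊔ LinearMap.ker φ.toLinearMap * augIdeal εA) :
    ∀ n : ℕ, 1 ≤ n → LinearMap.ker φ.toLinearMap ≤ augIdeal εA ^ n ∧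
      Function.Bijective (Submodule.mapQ (augIdeal εA ^ n) (augIdeal εB ^ n) φ.toLinearMap
        (by
          intro a ha
          have hmap : (augIdeal εA).map φ.toLinearMap ≤ augIdeal εB := by
            rintro b ⟨x, hx, rfl⟩
            have : εB (φ x) = εA x := by rw [← hφ]; rfl
            simpa [augIdeal, LinearMap.mem_ker, this] using hx
          have : (augIdeal εA ^ n).map φ.toLinearMap ≤ augIdeal εB ^ n := by
            rw [Submodule.map_pow]
            exact pow_le_pow_left' hmap n
          exact this ⟨a, ha, rfl⟩)) := by
  intro n hn
  have hker : LinearMap.ker φ.toLinearMap ≤ augIdeal εA ^ n :=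
    Submodule.le_pow_of_le_mul_sup_mul (ker_le_augIdeal hφ) h2.le hn
  refine ⟨hker, ?_, ?_⟩
  · rw [← LinearMap.ker_eq_bot, Submodule.mapQ, Submodule.ker_liftQ, LinearMap.ker_comp,
      Submodule.ker_mkQ, ← map_augIdeal_of_surjective hφ hsurj, ← Submodule.map_pow,
      Submodule.comap_map_eq_self hker]
    exact Submodule.mkQ_map_self _
  · rw [← LinearMap.range_eq_top, Submodule.range_mapQ, LinearMap.range_eq_top.2 hsurj,
      Submodule.map_top, Submodule.range_mkQ]
end

section
/- Let X be a linearly ordered type, let W(X) be the free monoid on X (words in the alphabet X), and let M be a monoid equipped with an admissible order, i.e. a linear order ≤ such that 1 < m for every m ≠ 1 in M and such that m₁ < m₂ implies m′m₁m″ < m′m₂m″ for all m′, m″ ∈ M. Let θ : W(X) → M be a monoid homomorphism such that θ(w) = 1 implies w = 1. Define the θ-lex relation on W(X) by: u <_θ v if and only if θ(u) < θ(v), or θ(u) = θ(v) and u is smaller than v in the lexicographic order on words induced by the order on X. Then <_θ is a strict linear order on W(X) which is admissible: 1 <_θ w for every word w ≠ 1, and w₁ <_θ w₂ implies u·w₁·v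 <_θ u·w₂·v for all words u, v. Moreover, if X is finite and M is the additive monoid ℕ with its usual order (so θ(uv) = θ(u) + θ(v) and θ(x) ≥ 1 for every letter x ∈ X), then every subset of W(X) that is bounded above with respect to <_θ is finite. -/
/-- The `θ`-lex relation on the free monoid `W(X)`: `u <_θ v` iff `θ u < θ v`, or
`θ u = θ v` and `u` is lexicographically smaller than `v`. -/
def thetaLex {X M : Type*} [LinearOrder X] [LT M] (θ : FreeMonoid X → M)
    (u v : FreeMonoid X) : Prop :=
  θ u < θ v ∨ (θ u = θ v ∧ List.Lex (· < ·) (FreeMonoid.toList u) (FreeMonoid.toList v))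

namespace List

/-- If `a` is lexicographically smaller than `b`, then either `a` is a proper prefix of `b`, or
the comparison is decided at a letter and survives appending arbitrary words. -/
theorem Lex.prefix_or_append {α : Type*} {r : α → α → Prop} {a b : List α}
    (h : List.Lex r a b) :
    (∃ p, p ≠ [] ∧ b = a ++ p) ∨ ∀ s t, List.Lex r (a ++ s) (b ++ t) := by
  induction h with
  | nil => exact Or.inl ⟨_, by simp, rfl⟩
  | rel h => exact Or.inr fun s t => Lex.rel h
  | cons _ ih =>
    rcases ih with ⟨p, hp, rfl⟩ | h
    · exact Or.inl ⟨p, hp, rfl⟩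
    · exact Or.inr fun s t => Lex.cons (h s t)

end List

theorem FreeMonoid.length_le_of_additive {X : Type*} (θ : FreeMonoid X → ℕ)
    (hmul : ∀ u v : FreeMonoid X, θ (u * v) = θ u + θ v)
    (hof : ∀ x : X, 1 ≤ θ (FreeMonoid.of x)) (w : FreeMonoid X) :
    (FreeMonoid.toList w).length ≤ θ w := by
  induction w using FreeMonoid.recOn with
  | one => simp
  | of_mul x w ih =>
    have := hof x
    rw [hmul]
    simp only [FreeMonoid.toList_of_mul, List.length_cons]
    omega

theorem thetaLex_isStrictTotalOrder {X M : Type*} [LinearOrder X] [LinearOrder M]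
    (θ : FreeMonoid X → M) : IsStrictTotalOrder (FreeMonoid X) (thetaLex θ) where
  trichotomous u v huv hvu := by
    simp only [thetaLex, not_or, not_and, not_lt] at huv hvu
    have h : θ u = θ v := le_antisymm hvu.1 huv.1
    exact FreeMonoid.toList.injective
      (Std.Trichotomous.trichotomous (r := List.Lex (· < ·)) _ _ (huv.2 h) (hvu.2 h.symm))
  irrefl u := by
    rintro (h | ⟨-, h⟩)
    · exact lt_irrefl _ h
    · exact lt_irrefl (FreeMonoid.toList u) h
  trans u v w := by
    rintro (h | ⟨h, hl⟩) (h' | ⟨h', hl'⟩)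
    · exact Or.inl (h.trans h')
    · exact Or.inl (h' ▸ h)
    · exact Or.inl (h ▸ h')
    · exact Or.inr ⟨h.trans h', lt_trans (α := List X) hl hl'⟩

/-- Let `M` be a monoid with an admissible order and `θ : W(X) → M` a monoid homomorphism
with `θ w = 1 → w = 1`.  Then the `θ`-lex relation is a strict linear order on `W(X)` which
is admissible: `1 <_θ w` for `w ≠ 1`, and it is strictly compatible with two-sided
multiplication.  Moreover, if `X` is finite and `M = ℕ` (additively, with its usual order,
`θ` sending each letter to a positive number), then every subset of `W(X)` bounded above
with respect to `<_θ` is finite. -/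
theorem thetaLex_admissible_order
    {X M : Type*} [LinearOrder X] [Monoid M] [LinearOrder M]
    (hadm1 : ∀ m : M, m ≠ 1 → 1 < m)
    (hadm2 : ∀ m' m'' m₁ m₂ : M, m₁ < m₂ → m' * m₁ * m'' < m' * m₂ * m'')
    (θ : FreeMonoid X →* M) (hθ : ∀ w : FreeMonoid X, θ w = 1 → w = 1) :
    IsStrictTotalOrder (FreeMonoid X) (thetaLex θ)
    ∧ (∀ w : FreeMonoid X, w ≠ 1 → thetaLex θ 1 w)
    ∧ (∀ u v w₁ w₂ : FreeMonoid X, thetaLex θ w₁ w₂ →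
        thetaLex θ (u * w₁ * v) (u * w₂ * v))
    ∧ (∀ (_ : Finite X) (θ' : FreeMonoid X → ℕ)
        (_ : ∀ u v : FreeMonoid X, θ' (u * v) = θ' u + θ' v)
        (_ : ∀ x : X, 1 ≤ θ' (FreeMonoid.of x))
        (S : Set (FreeMonoid X)) (b : FreeMonoid X),
        (∀ w ∈ S, thetaLex θ' w b ∨ w = b) → S.Finite) := by
  refine ⟨thetaLex_isStrictTotalOrder θ, fun w hw => Or.inl ?_, ?_, ?_⟩
  · rw [map_one]
    exact hadm1 _ (mt (hθ w) hw)
  · rintro u v w₁ w₂ (h | ⟨h, hl⟩)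
    · refine Or.inl ?_
      simpa only [map_mul] using hadm2 _ _ _ _ h
    · rcases hl.prefix_or_append with ⟨p, hp, hw⟩ | happ
      · have hmul : w₂ = w₁ * FreeMonoid.ofList p := hw
        have hlt := hadm2 (θ w₁) 1 _ _
          (hadm1 (θ (FreeMonoid.ofList p)) (mt (hθ _) hp))
        rw [mul_one, mul_one, mul_one, ← map_mul, ← hmul] at hlt
        exact absurd h hlt.ne
      · refine Or.inr ⟨by simp only [map_mul, h], ?_⟩
        simp only [FreeMonoid.toList_mul, List.append_assoc]
        exact List.Lex.append_left _ (happ _ _) _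
  · intro _ θ' hmul hof S b hS
    refine (List.finite_length_le X (θ' b)).subset fun w hw => ?_
    have hle : θ' w ≤ θ' b := by
      rcases hS w hw with (h | ⟨h, -⟩) | rfl
      · exact h.le
      · exact h.le
      · exact le_rfl
    exact (FreeMonoid.length_le_of_additive θ' hmul hof w).trans hle
end

section
/- Let k be a commutative ring and let F be the free associative unital k-algebra on three generators x₁, x₂, x₃. Let A = F/J, where J is the two-sided ideal of F generated by the single element x₁x₂ + x₃² − x₃, equipped with the augmentation ε_A : A → k induced by the algebra map F → k sending each generator to 0. Then A is residually nilpotent: ⋂_{n≥1} I(A)ⁿ = 0. -/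
noncomputable section

variable (k : Type*) [CommRing k]

/-- The relation identifying `x₁x₂ + x₃² − x₃` with `0` in the free algebra on
three generators. -/
def relExample : FreeAlgebra k (Fin 3) → FreeAlgebra k (Fin 3) → Prop := fun a b =>
  a = FreeAlgebra.ι k 0 * FreeAlgebra.ι k 1 +
      FreeAlgebra.ι k 2 * FreeAlgebra.ι k 2 - FreeAlgebra.ι k 2 ∧ b = 0

/-- `A = k⟨x₁,x₂,x₃ ∣ x₁x₂ + x₃² − x₃⟩`, the quotient of the free algebra by the two-sided
ideal generated by the single relation. -/
def ExampleAlgebra : Type _ := RingQuot (relExample k)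

instance : Ring (ExampleAlgebra k) := by unfold ExampleAlgebra; infer_instance
instance : Algebra k (ExampleAlgebra k) := by unfold ExampleAlgebra; infer_instance

/-- The augmentation of `ExampleAlgebra k`, induced by sending every generator to `0`. -/
def exampleAug : ExampleAlgebra k →ₐ[k] k :=
  RingQuot.liftAlgHom k
    ⟨FreeAlgebra.lift k (fun _ => (0 : k)), by
      rintro a b ⟨rfl, rfl⟩
      simp⟩

/-- The operator on functions of binary words that prepends the letter `c`, truncated to words of
length less than `N`. -/
def prependLetter (N : ℕ) (c : Bool) : Module.End k (List Bool → k) where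
  toFun f w := match w with
    | [] => 0
    | d :: u => if d = c ∧ u.length + 1 < N then f u else 0
  map_add' f g := by
    ext w
    rcases w with _ | ⟨d, u⟩
    · simp
    · by_cases h : d = c ∧ u.length + 1 < N <;> simp [h]
  map_smul' r f := by
    ext w
    rcases w with _ | ⟨d, u⟩
    · simp
    · by_cases h : d = c ∧ u.length + 1 < N <;> simp [h]

@[simp] lemma prependLetter_nil (N : ℕ) (c : Bool) (f : List Bool → k) :
    prependLetter k N c f [] = 0 := rfl

@[simp] lemma prependLetter_cons (N : ℕ) (c d : Bool) (f : List Bool → k) (u : List Bool) :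
    prependLetter k N c f (d :: u) = if d = c ∧ u.length + 1 < N then f u else 0 := rfl

/-- Functions on binary words vanishing on all words of length less than `n`. -/
def wordOrder (n : ℕ) : Submodule k (List Bool → k) where
  carrier := {f | ∀ w, w.length < n → f w = 0}
  add_mem' hf hg w hw := by simp [hf w hw, hg w hw]
  zero_mem' _ _ := rfl
  smul_mem' r f hf w hw := by simp [hf w hw]

/-- Operators raising the order of functions on binary words by at least `n`. -/
def raising (n : ℕ) : Submodule k (Module.End k (List Bool → k)) where
  carrier := {L | ∀ m, ∀ f ∈ wordOrder k m, L f ∈ wordOrder k (m + n)}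
  add_mem' hL hM m f hf := add_mem (hL m f hf) (hM m f hf)
  zero_mem' _ _ _ := zero_mem _
  smul_mem' r _ hL m f hf := Submodule.smul_mem _ r (hL m f hf)

variable {k}

lemma raising_anti {m n : ℕ} (h : m ≤ n) : raising k n ≤ raising k m :=
  fun _ hL d f hf w hw => hL d f hf w (by omega)

lemma mul_mem_raising {m n : ℕ} {L M : Module.End k (List Bool → k)}
    (hL : L ∈ raising k m) (hM : M ∈ raising k n) : L * M ∈ raising k (m + n) := by
  intro d f hf
  have := hL _ _ (hM d f hf)
  rwa [add_assoc, add_comm n m] at this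

lemma one_mem_raising : (1 : Module.End k (List Bool → k)) ∈ raising k 0 :=
  fun _ _ hf => hf

lemma algebraMap_mem_raising (r : k) :
    algebraMap k (Module.End k (List Bool → k)) r ∈ raising k 0 := by
  rw [Algebra.algebraMap_eq_smul_one]
  exact Submodule.smul_mem _ r one_mem_raising

lemma prependLetter_mem_raising (N : ℕ) (c : Bool) : prependLetter k N c ∈ raising k 1 := by
  rintro m f hf (_ | ⟨d, u⟩) hw
  · rfl
  · have : f u = 0 := hf u (by simpa using hw)
    simp [this]

variable (k)

/-- Operators whose values vanish on words of length at least `N`. -/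
def truncated (N : ℕ) : Submodule k (Module.End k (List Bool → k)) where
  carrier := {L | ∀ f w, N ≤ w.length → L f w = 0}
  add_mem' hL hM f w hw := by simp [hL f w hw, hM f w hw]
  zero_mem' _ _ _ := rfl
  smul_mem' r L hL f w hw := by simp [hL f w hw]

/-- The approximations to the solution of `z = x₁x₂ + z²` obtained by iteration from `0`. -/
def catalanApprox (N : ℕ) : ℕ → Module.End k (List Bool → k)
  | 0 => 0
  | n + 1 => prependLetter k N true * prependLetter k N false +
      catalanApprox N n * catalanApprox N n

variable {k}

lemma mul_mem_truncated {N : ℕ} {L : Module.End k (List Bool → k)} (hL : L ∈ truncated k N)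
    (M : Module.End k (List Bool → k)) : L * M ∈ truncated k N :=
  fun f w hw => hL (M f) w hw

lemma prependLetter_mem_truncated (N : ℕ) (c : Bool) :
    prependLetter k N c ∈ truncated k N := by
  rintro f (_ | ⟨d, u⟩) hw
  · rfl
  · have : ¬ u.length + 1 < N := by simpa using hw
    simp [this]

lemma eq_zero_of_mem_truncated_of_mem_raising {N : ℕ} {L : Module.End k (List Bool → k)}
    (hT : L ∈ truncated k N) (hR : L ∈ raising k N) : L = 0 := by
  ext1 f
  funext w
  by_cases hw : N ≤ w.length
  · exact hT f w hw
  · exact hR 0 f (fun _ h => absurd h (by omega)) w (by omega)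

lemma catalanApprox_mem_truncated (N n : ℕ) : catalanApprox k N n ∈ truncated k N := by
  induction n with
  | zero => exact zero_mem _
  | succ n ih =>
    exact add_mem (mul_mem_truncated (prependLetter_mem_truncated N _) _) (mul_mem_truncated ih _)

lemma catalanApprox_mem_raising (N n : ℕ) : catalanApprox k N n ∈ raising k 2 := by
  induction n with
  | zero => exact zero_mem _
  | succ n ih =>
    exact add_mem
      (mul_mem_raising (prependLetter_mem_raising N _) (prependLetter_mem_raising N _))
      (raising_anti (by omega) (mul_mem_raising ih ih))

lemma catalanApprox_succ_sub_mem_raising (N n : ℕ) :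
    catalanApprox k N (n + 1) - catalanApprox k N n ∈ raising k n := by
  induction n with
  | zero =>
    exact sub_mem (raising_anti (by omega) (catalanApprox_mem_raising N 1))
      (raising_anti (by omega) (catalanApprox_mem_raising N 0))
  | succ n ih =>
    have h : catalanApprox k N (n + 1 + 1) - catalanApprox k N (n + 1) =
        catalanApprox k N (n + 1) * (catalanApprox k N (n + 1) - catalanApprox k N n) +
        (catalanApprox k N (n + 1) - catalanApprox k N n) * catalanApprox k N n := by
      have e (m : ℕ) : catalanApprox k N (m + 1) =
          prependLetter k N true * prependLetter k N false +
            catalanApprox k N m * catalanApprox k N m := rfl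
      rw [mul_sub, sub_mul, sub_add_sub_cancel, e (n + 1)]
      nth_rw 3 [e n]
      rw [add_sub_add_left_eq_sub]
    rw [h]
    exact add_mem
      (raising_anti (by omega) (mul_mem_raising (catalanApprox_mem_raising N _) ih))
      (raising_anti (by omega) (mul_mem_raising ih (catalanApprox_mem_raising N _)))

lemma catalanApprox_self (N : ℕ) :
    prependLetter k N true * prependLetter k N false +
      catalanApprox k N N * catalanApprox k N N = catalanApprox k N N :=
  sub_eq_zero.mp <| eq_zero_of_mem_truncated_of_mem_raising
    (sub_mem (catalanApprox_mem_truncated N (N + 1)) (catalanApprox_mem_truncated N N))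
    (catalanApprox_succ_sub_mem_raising N N)

variable (k)

/-- The representation of the free algebra by truncated operators on functions of words. -/
def freeWordRep (N : ℕ) : FreeAlgebra k (Fin 3) →ₐ[k] Module.End k (List Bool → k) :=
  FreeAlgebra.lift k
    ![prependLetter k N true, prependLetter k N false, catalanApprox k N N]

/-- The representation of `ExampleAlgebra k` by truncated operators on functions of words. -/
def wordRep (N : ℕ) : ExampleAlgebra k →ₐ[k] Module.End k (List Bool → k) :=
  RingQuot.liftAlgHom k ⟨freeWordRep k N, by
    rintro a b ⟨rfl, rfl⟩
    simp [freeWordRep, catalanApprox_self]⟩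

/-- The quotient map from the free algebra. -/
def exampleMk : FreeAlgebra k (Fin 3) →ₐ[k] ExampleAlgebra k :=
  RingQuot.mkAlgHom k (relExample k)

lemma exampleMk_surjective : Function.Surjective (exampleMk k) :=
  RingQuot.mkAlgHom_surjective k (relExample k)

/-- The generators of `ExampleAlgebra k`. -/
def exampleGen (i : Fin 3) : ExampleAlgebra k := exampleMk k (FreeAlgebra.ι k i)

lemma exampleGen_relation : exampleGen k 0 * exampleGen k 1 =
    exampleGen k 2 - exampleGen k 2 * exampleGen k 2 := by
  have h : exampleMk k (FreeAlgebra.ι k 0 * FreeAlgebra.ι k 1 +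
      FreeAlgebra.ι k 2 * FreeAlgebra.ι k 2 - FreeAlgebra.ι k 2) = exampleMk k 0 :=
    RingQuot.mkAlgHom_rel k ⟨rfl, rfl⟩
  simp only [map_sub, map_add, map_mul, map_zero] at h
  change exampleGen k 0 * exampleGen k 1 + exampleGen k 2 * exampleGen k 2 - exampleGen k 2 = 0
    at h
  rw [← sub_eq_zero, ← h]
  abel

lemma wordRep_exampleMk (N : ℕ) (y : FreeAlgebra k (Fin 3)) :
    wordRep k N (exampleMk k y) = freeWordRep k N y :=
  RingQuot.liftAlgHom_mkAlgHom_apply k _ _ _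

lemma exampleAug_exampleMk (y : FreeAlgebra k (Fin 3)) :
    exampleAug k (exampleMk k y) = FreeAlgebra.lift k (fun _ => (0 : k)) y :=
  RingQuot.liftAlgHom_mkAlgHom_apply k _ _ _

lemma wordRep_exampleGen (N : ℕ) (i : Fin 3) : wordRep k N (exampleGen k i) =
    ![prependLetter k N true, prependLetter k N false, catalanApprox k N N] i := by
  rw [exampleGen, wordRep_exampleMk, freeWordRep, FreeAlgebra.lift_ι_apply]

lemma freeWordRep_sub_mem_raising (N : ℕ) (y : FreeAlgebra k (Fin 3)) :
    freeWordRep k N y - algebraMap k _ (FreeAlgebra.lift k (fun _ => (0 : k)) y) ∈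
      raising k 1 := by
  induction y using FreeAlgebra.induction with
  | grade0 r => simp
  | grade1 i =>
    simp only [freeWordRep, FreeAlgebra.lift_ι_apply, map_zero, sub_zero]
    fin_cases i
    · exact prependLetter_mem_raising N _
    · exact prependLetter_mem_raising N _
    · exact raising_anti (by omega) (catalanApprox_mem_raising N N)
  | add a b ha hb =>
    simp only [map_add]
    rw [add_sub_add_comm]
    exact add_mem ha hb
  | mul a b ha hb =>
    simp only [map_mul]
    set r := algebraMap k (Module.End k (List Bool → k))
      (FreeAlgebra.lift k (fun _ => (0 : k)) a)
    set s := algebraMap k (Module.End k (List Bool → k))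
      (FreeAlgebra.lift k (fun _ => (0 : k)) b)
    have hb' : freeWordRep k N b ∈ raising k 0 := by
      rw [← sub_add_cancel (freeWordRep k N b) s]
      exact add_mem (raising_anti zero_le_one hb) (algebraMap_mem_raising _)
    have h : freeWordRep k N a * freeWordRep k N b - r * s =
        (freeWordRep k N a - r) * freeWordRep k N b + r * (freeWordRep k N b - s) := by
      rw [sub_mul, mul_sub, sub_add_sub_cancel]
    rw [h]
    exact add_mem (mul_mem_raising ha hb')
      (raising_anti (by omega) (mul_mem_raising (algebraMap_mem_raising _) hb))

lemma wordRep_mem_raising_of_mem_augIdeal (N : ℕ) {x : ExampleAlgebra k}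
    (hx : x ∈ augIdeal (exampleAug k)) : wordRep k N x ∈ raising k 1 := by
  obtain ⟨y, rfl⟩ := exampleMk_surjective k x
  have hy : FreeAlgebra.lift k (fun _ => (0 : k)) y = 0 := by
    rw [← exampleAug_exampleMk]
    exact hx
  simpa [wordRep_exampleMk, hy] using freeWordRep_sub_mem_raising k N y

lemma wordRep_mem_raising_of_mem_augIdeal_pow (N n : ℕ) {x : ExampleAlgebra k}
    (hx : x ∈ augIdeal (exampleAug k) ^ n) : wordRep k N x ∈ raising k n := by
  induction n generalizing x with
  | zero =>
    rw [pow_zero, Submodule.mem_one] at hx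
    obtain ⟨r, rfl⟩ := hx
    rw [AlgHom.commutes]
    exact algebraMap_mem_raising r
  | succ n ih =>
    rw [pow_succ] at hx
    induction hx using Submodule.mul_induction_on' with
    | mem_mul_mem a ha b hb =>
      rw [map_mul]
      exact mul_mem_raising (ih ha) (wordRep_mem_raising_of_mem_augIdeal k N hb)
    | add a _ b _ ha hb =>
      rw [map_add]
      exact add_mem ha hb

/-- The normal-form element attached to a binary word: each occurrence of the factor
`true, false` is read as `x₃`, and the remaining letters as `x₁` and `x₂`. -/
def normalWord : List Bool → ExampleAlgebra k
  | [] => 1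
  | true :: false :: w => exampleGen k 2 * normalWord w
  | true :: w => exampleGen k 0 * normalWord w
  | false :: w => exampleGen k 1 * normalWord w

lemma exampleGen_mul_normalWord_mem (i : Fin 3) (w : List Bool) :
    exampleGen k i * normalWord k w ∈ Submodule.span k (Set.range (normalWord k)) := by
  have mem (v : List Bool) : normalWord k v ∈ Submodule.span k (Set.range (normalWord k)) :=
    Submodule.subset_span ⟨v, rfl⟩
  fin_cases i
  · rcases w with _ | ⟨_ | _, w⟩
    · simpa [normalWord] using mem [true]
    · have h : exampleGen k 0 * normalWord k (false :: w) =
          normalWord k (true :: false :: w) -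
            normalWord k (true :: false :: true :: false :: w) := by
        simp only [normalWord]
        rw [← mul_assoc, exampleGen_relation, sub_mul, mul_assoc]
      change exampleGen k 0 * _ ∈ _
      rw [h]
      exact Submodule.sub_mem _ (mem _) (mem _)
    · simpa [normalWord] using mem (true :: true :: w)
  · simpa [normalWord] using mem (false :: w)
  · simpa [normalWord] using mem (true :: false :: w)

lemma span_range_normalWord : Submodule.span k (Set.range (normalWord k)) = ⊤ := by
  rw [eq_top_iff]
  rintro x -
  obtain ⟨y, rfl⟩ := exampleMk_surjective k x
  suffices h : ∀ z ∈ Submodule.span k (Set.range (normalWord k)),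
      exampleMk k y * z ∈ Submodule.span k (Set.range (normalWord k)) by
    simpa using h 1 (Submodule.subset_span ⟨[], by simp [normalWord]⟩)
  induction y using FreeAlgebra.induction with
  | grade0 r =>
    intro z hz
    rw [AlgHom.commutes, ← Algebra.smul_def]
    exact Submodule.smul_mem _ r hz
  | grade1 i =>
    intro z hz
    induction hz using Submodule.span_induction with
    | mem z hz =>
      obtain ⟨w, rfl⟩ := hz
      exact exampleGen_mul_normalWord_mem k i w
    | zero => simp
    | add a b _ _ ha hb =>
      rw [mul_add]
      exact add_mem ha hb
    | smul r a _ ha =>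
      rw [mul_smul_comm]
      exact Submodule.smul_mem _ r ha
  | add a b ha hb =>
    intro z hz
    rw [map_add, add_mul]
    exact add_mem (ha z hz) (hb z hz)
  | mul a b ha hb =>
    intro z hz
    rw [map_mul, mul_assoc]
    exact ha _ (hb z hz)

lemma wordRep_normalWord_mem_raising (N : ℕ) (w : List Bool) :
    wordRep k N (normalWord k w) ∈ raising k w.length := by
  induction w using normalWord.induct with
  | case1 => simpa [normalWord] using one_mem_raising
  | case2 w ih =>
    rw [normalWord, map_mul, wordRep_exampleGen]
    exact raising_anti (by grind) (mul_mem_raising (catalanApprox_mem_raising N N) ih)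
  | case3 w h ih =>
    rw [normalWord.eq_3 k w h, map_mul, wordRep_exampleGen]
    exact raising_anti (by grind) (mul_mem_raising (prependLetter_mem_raising N true) ih)
  | case4 w ih =>
    rw [normalWord, map_mul, wordRep_exampleGen]
    exact raising_anti (by grind) (mul_mem_raising (prependLetter_mem_raising N false) ih)

lemma mem_wordOrder_zero (f : List Bool → k) : f ∈ wordOrder k 0 :=
  fun _ h => absurd h (by omega)

/-- The leading part of the power series attached to a normal word is that word. -/
lemma wordRep_normalWord_apply (N : ℕ) (w v : List Bool) (hN : w.length < N)
    (hv : v.length = w.length) :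
    wordRep k N (normalWord k w) (Pi.single [] 1) v = if v = w then 1 else 0 := by
  induction w using normalWord.induct generalizing v with
  | case1 =>
    obtain rfl : v = [] := by simpa using hv
    simp [normalWord]
  | case2 w ih =>
    obtain ⟨c, d, u, rfl⟩ : ∃ c d u, v = c :: d :: u := by
      match v, hv with
      | c :: d :: u, _ => exact ⟨c, d, u, rfl⟩
    have hN' : w.length + 2 < N := by simpa using hN
    have hu : u.length = w.length := by simpa using hv
    have hsq : (catalanApprox k N N * catalanApprox k N N)
        (wordRep k N (normalWord k w) (Pi.single [] 1)) (c :: d :: u) = 0 :=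
      mul_mem_raising (mul_mem_raising (catalanApprox_mem_raising N N)
        (catalanApprox_mem_raising N N)) (wordRep_normalWord_mem_raising k N w) 0 _
        (mem_wordOrder_zero k _) _ (by simp; omega)
    rw [normalWord, map_mul, wordRep_exampleGen]
    change catalanApprox k N N _ _ = _
    rw [← catalanApprox_self, LinearMap.add_apply, Pi.add_apply, hsq, add_zero,
      Module.End.mul_apply, prependLetter_cons, prependLetter_cons, ih u (by omega) hu]
    have h1 : u.length + 1 < N := by omega
    have h2 : u.length + 1 + 1 < N := by omega
    cases c <;> cases d <;> simp [h1, h2]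
  | case3 w h ih =>
    obtain ⟨c, u, rfl⟩ : ∃ c u, v = c :: u := by
      match v, hv with
      | c :: u, _ => exact ⟨c, u, rfl⟩
    have hu : u.length = w.length := by simpa using hv
    have hN' : w.length + 1 < N := by simpa using hN
    rw [normalWord.eq_3 k w h, map_mul, wordRep_exampleGen]
    change prependLetter k N true (wordRep k N (normalWord k w) (Pi.single [] 1)) (c :: u) = _
    rw [prependLetter_cons, ih u (by omega) hu]
    cases c <;> simp [hu, hN']
  | case4 w ih =>
    obtain ⟨c, u, rfl⟩ : ∃ c u, v = c :: u := by
      match v, hv with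
      | c :: u, _ => exact ⟨c, u, rfl⟩
    have hu : u.length = w.length := by simpa using hv
    have hN' : w.length + 1 < N := by simpa using hN
    rw [normalWord, map_mul, wordRep_exampleGen]
    change prependLetter k N false (wordRep k N (normalWord k w) (Pi.single [] 1)) (c :: u) = _
    rw [prependLetter_cons, ih u (by omega) hu]
    cases c <;> simp [hu, hN']

/-- The augmented algebra `k⟨x₁,x₂,x₃ ∣ x₁x₂ + x₃² − x₃⟩` is residually nilpotent:
`⋂_{n ≥ 1} I(A)ⁿ = 0`. -/
theorem exampleAlgebra_residually_nilpotent :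
    (⨅ n ∈ {n : ℕ | 1 ≤ n}, augIdeal (exampleAug k) ^ n) = ⊥ := by
  rw [eq_bot_iff]
  intro x hx
  simp only [Submodule.mem_iInf, Set.mem_ofPred_eq] at hx
  obtain ⟨c, rfl⟩ := (Finsupp.mem_span_range_iff_exists_finsupp).mp
    (span_range_normalWord k ▸ Submodule.mem_top : x ∈ Submodule.span k (Set.range (normalWord k)))
  suffices c = 0 by simp [this]
  by_contra hc
  obtain ⟨w, hw, hmin⟩ := c.support.exists_min_image List.length (Finsupp.support_nonempty_iff.mpr hc)
  refine Finsupp.mem_support_iff.mp hw ?_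
  have h := wordRep_mem_raising_of_mem_augIdeal_pow k (w.length + 1) (w.length + 1)
    (hx (w.length + 1) (by omega)) 0 (Pi.single [] 1) (mem_wordOrder_zero k _) w (by omega)
  rw [Finsupp.sum, map_sum, LinearMap.sum_apply, Finset.sum_apply, Finset.sum_eq_single w] at h
  · simpa [wordRep_normalWord_apply] using h
  · intro v hv hvw
    rw [map_smul, LinearMap.smul_apply, Pi.smul_apply]
    rcases (hmin v hv).eq_or_lt with hlen | hlen
    · rw [wordRep_normalWord_apply k _ v w (by omega) hlen, if_neg (Ne.symm hvw), smul_zero]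
    · rw [wordRep_normalWord_mem_raising k _ v 0 _ (mem_wordOrder_zero k _) w (by omega), smul_zero]
  · exact fun h => absurd hw h
end
end

section
/- Let k be a commutative ring and let F be the free associative unital k-algebra on n + m generators x₁, …, xₙ (the x-generators) and y₁, …, y_m (the y-generators). Let u be a nonempty word in the x-generators only which admits no decomposition u = u′u″u′ with u′ a nonempty word in the x-generators and u″ a (possibly empty) word in the x-generators. Let φ ∈ F be a finite k-linear combination of nonempty words in the y-generators only, each of length at most the length of u. Let A = F/J, where J is the two-sided ideal of F generated by u − φ, with the augmentation induced by the algebra map F → k sending every generator to 0 (well defined since u and all words of φ are nonempty). Then A is residually nilpotent: ⋂_{n≥1} I(A)ⁿ = 0. -/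
noncomputable section

/-- The element of the free algebra given by a word in the generators. -/
def wordProd (k : Type*) [CommRing k] {ι : Type*} (l : List ι) : FreeAlgebra k ι :=
  (l.map (FreeAlgebra.ι k)).prod

namespace List

variable {α : Type*}

/-- A word having a nonempty proper border has a non-overlapping one. -/
theorem exists_eq_append_append_of_border {u a c d : List α} (ha : a ≠ []) (hc : c ≠ [])
    (h₁ : u = a ++ c) (h₂ : u = c ++ d) : ∃ p q : List α, p ≠ [] ∧ u = p ++ q ++ p := by
  induction hn : c.length using Nat.strong_induction_on generalizing a c d with
  | _ N ih =>
    have h : a ++ c = c ++ d := h₁.symm.trans h₂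
    have hca : a <+: a ++ c := prefix_append a c
    have hcc : c <+: a ++ c := h ▸ prefix_append c d
    rcases le_total c.length a.length with hle | hle
    · obtain ⟨e, rfl⟩ := prefix_of_prefix_length_le hcc hca hle
      exact ⟨c, e, hc, h₁⟩
    · obtain ⟨c', rfl⟩ := prefix_of_prefix_length_le hca hcc hle
      rw [append_assoc, append_cancel_left_eq] at h
      rcases eq_or_ne c' [] with rfl | hc'
      · exact ⟨a, [], ha, by simpa using h₁⟩
      · refine ih c'.length ?_ (a := a ++ a) (c := c') (d := d ++ d)
          (by simp [ha]) hc' (by simpa using h₁) ?_ rfl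
        · have := length_pos_iff.2 ha
          simp at hn
          omega
        · rw [h₂, h, append_assoc]

end List

namespace FreeAlgebra

variable {k X : Type*} [CommRing k]

theorem wordProd_nil : wordProd k ([] : List X) = 1 := rfl

theorem wordProd_cons (x : X) (l : List X) : wordProd k (x :: l) = ι k x * wordProd k l := by
  simp [wordProd]

theorem wordProd_append (l l' : List X) :
    wordProd k (l ++ l') = wordProd k l * wordProd k l' := by
  simp [wordProd]

/-- The basis of the free algebra consisting of words. -/
def wordBasis (k X : Type*) [CommRing k] : Module.Basis (List X) k (FreeAlgebra k X) :=
  (basisFreeMonoid k X).reindex FreeMonoid.toList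

theorem wordBasis_apply (l : List X) : wordBasis k X l = wordProd k l := by
  induction l with
  | nil => simp [wordBasis, basisFreeMonoid, wordProd]; rfl
  | cons x l ih =>
    rw [wordProd_cons, ← ih]
    simp [wordBasis, basisFreeMonoid, equivMonoidAlgebraFreeMonoid]

/-- The span of the words of length at least `j`. -/
def wordSpan (k X : Type*) [CommRing k] (j : ℕ) : Submodule k (FreeAlgebra k X) :=
  Submodule.span k (wordProd k '' {l : List X | j ≤ l.length})

theorem wordProd_mem_wordSpan {j : ℕ} {l : List X} (h : j ≤ l.length) :
    wordProd k l ∈ wordSpan k X j :=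
  Submodule.subset_span ⟨l, h, rfl⟩

theorem wordSpan_mul_le (i j : ℕ) :
    wordSpan k X i * wordSpan k X j ≤ wordSpan k X (i + j) := by
  rw [wordSpan, wordSpan, Submodule.span_mul_span, Submodule.span_le]
  rintro _ ⟨_, ⟨l, hl, rfl⟩, _, ⟨l', hl', rfl⟩, rfl⟩
  simp only [← wordProd_append]
  refine wordProd_mem_wordSpan ?_
  simp at hl hl' ⊢
  omega

theorem wordSpan_pow_le (j : ℕ) : wordSpan k X 1 ^ j ≤ wordSpan k X j := by
  induction j with
  | zero =>
    rw [pow_zero, Submodule.one_le, ← wordProd_nil (k := k) (X := X)]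
    exact wordProd_mem_wordSpan (Nat.zero_le _)
  | succ j ih =>
    rw [pow_succ]
    exact (mul_le_mul_left ih _).trans (wordSpan_mul_le j 1)

theorem mem_wordSpan_zero (f : FreeAlgebra k X) : f ∈ wordSpan k X 0 := by
  have h := (wordBasis k X).mem_span f
  refine Submodule.span_mono ?_ h
  rintro _ ⟨l, rfl⟩
  exact ⟨l, Nat.zero_le _, (wordBasis_apply l).symm⟩

/-- An element lying in the span of arbitrarily long words vanishes. -/
theorem eq_zero_of_forall_mem_wordSpan {f : FreeAlgebra k X} (h : ∀ j, f ∈ wordSpan k X j) :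
    f = 0 := by
  rw [← (wordBasis k X).repr.map_eq_zero_iff]
  ext l
  by_contra hl
  have h' := h (l.length + 1)
  rw [wordSpan, show (wordProd k : List X → _) = wordBasis k X from
    funext fun l => (wordBasis_apply l).symm, Module.Basis.mem_span_image] at h'
  have := h' (Finsupp.mem_support_iff.2 hl)
  simp at this

theorem exists_sub_algebraMap_mem_wordSpan_one (f : FreeAlgebra k X) :
    ∃ c : k, f - algebraMap k _ c ∈ wordSpan k X 1 := by
  induction mem_wordSpan_zero f using Submodule.span_induction with
  | mem f hf =>
    obtain ⟨l, -, rfl⟩ := hf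
    rcases eq_or_ne l [] with rfl | hl
    · exact ⟨1, by simp [wordProd_nil]⟩
    · exact ⟨0, by simpa using wordProd_mem_wordSpan (List.length_pos_iff.2 hl)⟩
  | zero => exact ⟨0, by simp⟩
  | add f g _ _ hf hg =>
    obtain ⟨c, hc⟩ := hf
    obtain ⟨d, hd⟩ := hg
    refine ⟨c + d, ?_⟩
    rw [map_add, add_sub_add_comm]
    exact add_mem hc hd
  | smul a f _ hf =>
    obtain ⟨c, hc⟩ := hf
    refine ⟨a • c, ?_⟩
    rw [Algebra.algebraMap_eq_smul_one, smul_assoc, ← smul_sub, ← Algebra.algebraMap_eq_smul_one]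
    exact Submodule.smul_mem _ a hc

section Reduce

variable (U : List X) (φ : FreeAlgebra k X)

open scoped Classical in
/-- Replace the occurrences of `U` in a word by `φ`, scanning from left to right. -/
def reduceWord : List X → FreeAlgebra k X
  | [] => 1
  | x :: t => if U <+: x :: t then φ * reduceWord (t.drop (U.length - 1))
      else ι k x * reduceWord t
termination_by l => l.length

/-- The linear extension of `reduceWord`. -/
def reduce : FreeAlgebra k X →ₗ[k] FreeAlgebra k X :=
  (wordBasis k X).constr k (reduceWord U φ)

theorem reduce_wordProd (l : List X) : reduce U φ (wordProd k l) = reduceWord U φ l := by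
  rw [← wordBasis_apply, reduce, Module.Basis.constr_basis]

theorem reduceWord_nil : reduceWord U φ [] = 1 := by
  rw [reduceWord]

variable {U}

theorem reduceWord_append_left (hU : U ≠ []) (b : List X) :
    reduceWord U φ (U ++ b) = φ * reduceWord U φ b := by
  obtain ⟨x, t, rfl⟩ := List.exists_cons_of_ne_nil hU
  have h : x :: t <+: x :: (t ++ b) := List.prefix_append (x :: t) b
  rw [List.cons_append, reduceWord, if_pos h]
  simp

theorem reduceWord_cons_of_not_matching {x : X} {t : List X} (h : ¬ U <+: x :: t) :
    reduceWord U φ (x :: t) = ι k x * reduceWord U φ t := by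
  rw [reduceWord, if_neg h]

/-- Case analysis along the left-to-right scan for occurrences of `U`. -/
theorem scan_induction (hU : U ≠ []) {P : List X → Prop} (nil : P [])
    (append : ∀ b, P b → P (U ++ b)) (cons : ∀ x t, ¬ U <+: x :: t → P t → P (x :: t))
    (l : List X) : P l := by
  induction hn : l.length using Nat.strong_induction_on generalizing l with
  | _ N ih =>
    by_cases h : U <+: l
    · obtain ⟨b, rfl⟩ := h
      have := List.length_pos_iff.2 hU
      exact append b (ih _ (by simp at hn; omega) b rfl)
    · cases l with
      | nil => exact nil
      | cons x t => exact cons x t h (ih _ (by simp at hn; omega) t rfl)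

theorem reduceWord_append (hU : U ≠ []) {v : List X}
    (hv : ∀ a, a ≠ [] → U <+: a ++ v → U <+: a) (a : List X) :
    reduceWord U φ (a ++ v) = reduceWord U φ a * reduceWord U φ v := by
  induction a using scan_induction hU with
  | nil => simp [reduceWord_nil]
  | append b ih =>
    rw [List.append_assoc, reduceWord_append_left φ hU, reduceWord_append_left φ hU, ih, mul_assoc]
  | cons x t h ih =>
    have h' : ¬ U <+: x :: (t ++ v) := fun h' => h (hv (x :: t) (by simp) h')
    rw [List.cons_append, reduceWord_cons_of_not_matching φ h', reduceWord_cons_of_not_matching φ h, ih,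
      mul_assoc]

/-- If `U` occurs as a prefix of `a ++ v` without being a prefix of `a`, then it straddles. -/
theorem exists_eq_append_of_prefix_append {a v : List X} (h : U <+: a ++ v) (h' : ¬ U <+: a) :
    ∃ c, c ≠ [] ∧ U = a ++ c ∧ c <+: v := by
  obtain ⟨e, he⟩ := h
  rcases List.append_eq_append_iff.1 he with ⟨b, rfl, -⟩ | ⟨c, rfl, rfl⟩
  · exact absurd (List.prefix_append U b) h'
  · refine ⟨c, ?_, rfl, List.prefix_append c e⟩
    rintro rfl
    simp at h'

theorem reduceWord_append_append_left (hU : U ≠ [])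
    (hdec : ¬ ∃ a b : List X, a ≠ [] ∧ U = a ++ b ++ a) (a b : List X) :
    reduceWord U φ (a ++ (U ++ b)) = reduceWord U φ a * (φ * reduceWord U φ b) := by
  rw [reduceWord_append φ hU, reduceWord_append_left φ hU]
  intro a ha h
  by_contra h'
  obtain ⟨c, hc, hac, hcU⟩ := exists_eq_append_of_prefix_append h h'
  obtain ⟨d, hd⟩ := List.prefix_of_prefix_length_le hcU (List.prefix_append U b) (by simp [hac])
  exact hdec (List.exists_eq_append_append_of_border ha hc hac hd.symm)

theorem reduceWord_append_append_of_disjoint (hU : U ≠ []) {s : List X} (hs : s ≠ [])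
    (hsU : ∀ x ∈ s, x ∉ U) (a b : List X) :
    reduceWord U φ (a ++ (s ++ b)) = reduceWord U φ a * (wordProd k s * reduceWord U φ b) := by
  rw [reduceWord_append φ hU]
  · congr 1
    clear hs
    induction s with
    | nil => simp [wordProd_nil]
    | cons x s ih =>
      rw [List.cons_append, reduceWord_cons_of_not_matching, ih fun y hy => hsU y (by simp [hy]),
        wordProd_cons, mul_assoc]
      rintro ⟨e, he⟩
      obtain ⟨y, t, rfl⟩ := List.exists_cons_of_ne_nil hU
      simp at he
      exact hsU x (by simp) (by simp [he.1])
  · intro a _ h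
    by_contra h'
    obtain ⟨c, hc, rfl, e, he⟩ := exists_eq_append_of_prefix_append h h'
    obtain ⟨y, t, rfl⟩ := List.exists_cons_of_ne_nil hc
    obtain ⟨x, s, rfl⟩ := List.exists_cons_of_ne_nil hs
    simp at he
    exact hsU x (by simp) (by simp [he.1])

variable {φ}

theorem reduce_mul_wordProd_mul (hU : U ≠ [])
    (hdec : ¬ ∃ a b : List X, a ≠ [] ∧ U = a ++ b ++ a)
    (hφ : φ ∈ Submodule.span k (wordProd k '' {l : List X | l ≠ [] ∧ ∀ x ∈ l, x ∉ U}))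
    (p q : FreeAlgebra k X) :
    reduce U φ (p * wordProd k U * q) = reduce U φ (p * φ * q) := by
  induction mem_wordSpan_zero p using Submodule.span_induction with
  | zero => simp
  | add f g _ _ hf hg => simp only [add_mul, map_add, hf, hg]
  | smul a f _ hf => simp only [smul_mul_assoc, map_smul, hf]
  | mem p hp =>
  obtain ⟨a, -, rfl⟩ := hp
  induction mem_wordSpan_zero q using Submodule.span_induction with
  | zero => simp
  | add f g _ _ hf hg => simp only [mul_add, map_add, hf, hg]
  | smul a f _ hf => simp only [mul_smul_comm, map_smul, hf]
  | mem q hq =>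
  obtain ⟨b, -, rfl⟩ := hq
  have key : ∀ ψ ∈ Submodule.span k (wordProd k '' {l : List X | l ≠ [] ∧ ∀ x ∈ l, x ∉ U}),
      reduce U φ (wordProd k a * ψ * wordProd k b) =
        reduceWord U φ a * (ψ * reduceWord U φ b) := by
    intro ψ hψ
    induction hψ using Submodule.span_induction with
    | zero => simp
    | add f g _ _ hf hg => simp only [mul_add, add_mul, map_add, hf, hg]
    | smul a f _ hf => simp only [mul_smul_comm, smul_mul_assoc, map_smul, hf]
    | mem f hf =>
      obtain ⟨s, ⟨hs, hsU⟩, rfl⟩ := hf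
      rw [← wordProd_append, ← wordProd_append, reduce_wordProd, List.append_assoc,
        reduceWord_append_append_of_disjoint φ hU hs hsU]
  rw [key φ hφ, ← wordProd_append, ← wordProd_append, reduce_wordProd, List.append_assoc,
    reduceWord_append_append_left φ hU hdec]

theorem reduceWord_mem_wordSpan (hU : U ≠ []) (hφ : φ ∈ wordSpan k X 1) (l : List X) :
    ∀ i, i * U.length ≤ l.length → reduceWord U φ l ∈ wordSpan k X i := by
  have hpos := List.length_pos_iff.2 hU
  induction l using scan_induction hU with
  | nil =>
    intro i hi
    have : i = 0 := by
      simp at hi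
      tauto
    exact this ▸ mem_wordSpan_zero _
  | append b ih =>
    rintro (_ | i) hi
    · exact mem_wordSpan_zero _
    · rw [reduceWord_append_left φ hU, add_comm]
      refine wordSpan_mul_le 1 i (Submodule.mul_mem_mul hφ (ih i ?_))
      rw [add_mul, List.length_append] at hi
      omega
  | cons x t h ih =>
    rintro (_ | i) hi
    · exact mem_wordSpan_zero _
    · rw [reduceWord_cons_of_not_matching φ h, add_comm]
      refine wordSpan_mul_le 1 i (Submodule.mul_mem_mul ?_ (ih i ?_))
      · simpa [wordProd] using wordProd_mem_wordSpan (k := k) (l := [x]) (j := 1) (by simp)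
      · rw [add_mul, List.length_cons] at hi
        omega

theorem reduce_mem_wordSpan (hU : U ≠ []) (hφ : φ ∈ wordSpan k X 1) (i : ℕ)
    {f : FreeAlgebra k X} (hf : f ∈ wordSpan k X (i * U.length)) :
    reduce U φ f ∈ wordSpan k X i := by
  suffices h : wordSpan k X (i * U.length) ≤ (wordSpan k X i).comap (reduce U φ) from h hf
  rw [wordSpan, Submodule.span_le]
  rintro _ ⟨l, hl, rfl⟩
  simp only [Submodule.comap_coe, Set.mem_preimage, SetLike.mem_coe, reduce_wordProd]
  exact reduceWord_mem_wordSpan hU hφ l i hl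

theorem map_reduce_eq {A : Type*} [Ring A] [Algebra k A] (π : FreeAlgebra k X →ₐ[k] A)
    (hU : U ≠ []) (hπ : π (wordProd k U) = π φ) (f : FreeAlgebra k X) :
    π (reduce U φ f) = π f := by
  suffices h : π.toLinearMap ∘ₗ reduce U φ = π.toLinearMap from LinearMap.congr_fun h f
  refine (wordBasis k X).ext fun l => ?_
  simp only [wordBasis_apply, LinearMap.comp_apply, reduce_wordProd, AlgHom.toLinearMap_apply]
  induction l using scan_induction hU with
  | nil => rw [reduceWord_nil, wordProd_nil]
  | append b ih => rw [reduceWord_append_left φ hU, wordProd_append, map_mul, map_mul, ih, hπ]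
  | cons x t h ih =>
    rw [reduceWord_cons_of_not_matching φ h, wordProd_cons, map_mul, map_mul, ih]

end Reduce

end FreeAlgebra

/-- A linear map that does not see the defining relations, in any context `p * _ * q`, is
constant on the fibres of the projection to the quotient algebra. -/
theorem RingQuot.map_eq_of_mkAlgHom_eq {k F V : Type*} [CommRing k] [Ring F] [Algebra k F]
    [AddCommGroup V] [Module k V] {r : F → F → Prop} (ν : F →ₗ[k] V)
    (hν : ∀ a b, r a b → ∀ p q, ν (p * a * q) = ν (p * b * q)) {f g : F}
    (h : RingQuot.mkAlgHom k r f = RingQuot.mkAlgHom k r g) : ν f = ν g := by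
  have hrel : ∀ a b, RingQuot.Rel r a b → ∀ p q, ν (p * a * q) = ν (p * b * q) := by
    intro a b hab
    induction hab with
    | of h => exact hν _ _ h
    | add_left _ ih =>
      intro p q
      simp only [mul_add, add_mul, map_add, ih]
    | @mul_left a b c _ ih =>
      intro p q
      simpa only [mul_assoc] using ih p (c * q)
    | @mul_right a b c _ ih =>
      intro p q
      simpa only [mul_assoc] using ih (p * a) q
  have h' : Relation.EqvGen (RingQuot.Rel r) f g := by
    apply Quot.eqvGen_exact
    simpa [RingQuot.mkAlgHom_def, RingQuot.mkRingHom_def] using h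
  clear h
  induction h' with
  | rel a b hab => simpa using hrel a b hab 1 1
  | refl => rfl
  | symm _ _ _ ih => exact ih.symm
  | trans _ _ _ _ _ ih₁ ih₂ => exact ih₁.trans ih₂

/-- Powers of the augmentation ideal of a quotient of a free algebra are spanned by long words. -/
theorem augIdeal_pow_le {k X A : Type*} [CommRing k] [Ring A] [Algebra k A]
    (π : FreeAlgebra k X →ₐ[k] A) (hπ : Function.Surjective π) (ε : A →ₐ[k] k)
    (hε : ∀ x, ε (π (FreeAlgebra.ι k x)) = 0) (j : ℕ) :
    augIdeal ε ^ j ≤ (FreeAlgebra.wordSpan k X j).map π.toLinearMap := by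
  have h₁ : augIdeal ε ≤ (FreeAlgebra.wordSpan k X 1).map π.toLinearMap := by
    intro y hy
    obtain ⟨f, rfl⟩ := hπ y
    obtain ⟨c, hc⟩ := FreeAlgebra.exists_sub_algebraMap_mem_wordSpan_one f
    have hker : FreeAlgebra.wordSpan k X 1 ≤ LinearMap.ker (ε.comp π).toLinearMap := by
      rw [FreeAlgebra.wordSpan, Submodule.span_le]
      rintro _ ⟨l, hl, rfl⟩
      obtain ⟨x, t, rfl⟩ := List.exists_cons_of_ne_nil (List.length_pos_iff.1 hl)
      simp [FreeAlgebra.wordProd_cons, hε]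
    have hc₀ : c = 0 := by
      have h := hker hc
      have hy' : ε (π f) = 0 := hy
      simpa [hy'] using h
    exact ⟨f, by simpa [hc₀] using hc, rfl⟩
  refine (pow_le_pow_left' h₁ j).trans ?_
  rw [← Submodule.map_pow]
  exact Submodule.map_mono (FreeAlgebra.wordSpan_pow_le j)

/-- Let `u` be a nonempty word in the `x`-generators admitting no decomposition
`u = u′u″u′` with `u′` nonempty, and let `φ` be a `k`-linear combination of nonempty words
in the `y`-generators of lengths at most the length of `u`.  Then the algebra
`k⟨x₁,…,xₙ,y₁,…,y_m ∣ u = φ⟩`, with the augmentation sending every generator to `0`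
(which exists and is unique), is residually nilpotent. -/
theorem one_relator_residually_nilpotent
    (k : Type*) [CommRing k] (n m : ℕ) (lu : List (Fin n))
    (hne : lu ≠ [])
    (hdec : ¬ ∃ a b : List (Fin n), a ≠ [] ∧ lu = a ++ b ++ a)
    (φ : FreeAlgebra k (Fin n ⊕ Fin m))
    (hφ : φ ∈ Submodule.span k
      {w : FreeAlgebra k (Fin n ⊕ Fin m) | ∃ l : List (Fin m),
        l ≠ [] ∧ l.length ≤ lu.length ∧ w = wordProd k (l.map Sum.inr)}) :
    (∃ ε : RingQuot (fun a b => a = wordProd k (lu.map Sum.inl) ∧ b = φ) →ₐ[k] k,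
      ∀ i : Fin n ⊕ Fin m,
        ε (RingQuot.mkAlgHom k _ (FreeAlgebra.ι k i)) = 0)
    ∧ (∀ ε : RingQuot (fun a b => a = wordProd k (lu.map Sum.inl) ∧ b = φ) →ₐ[k] k,
        (∀ i : Fin n ⊕ Fin m, ε (RingQuot.mkAlgHom k _ (FreeAlgebra.ι k i)) = 0) →
        (⨅ j ∈ {j : ℕ | 1 ≤ j}, augIdeal ε ^ j) = ⊥) := by
  set U : List (Fin n ⊕ Fin m) := lu.map Sum.inl with hUdef
  have hU : U ≠ [] := by simpa [hUdef] using hne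
  have hUdec : ¬ ∃ a b : List (Fin n ⊕ Fin m), a ≠ [] ∧ U = a ++ b ++ a := by
    rintro ⟨a, b, ha, h⟩
    obtain ⟨c, a₂, rfl, hc, rfl⟩ := List.map_eq_append_iff.1 h
    obtain ⟨a₁, b₁, rfl, h₁, rfl⟩ := List.map_eq_append_iff.1 hc
    obtain rfl := List.map_injective_iff.2 Sum.inl_injective h₁
    exact hdec ⟨a₁, b₁, by simpa using ha, rfl⟩
  have hφ' : φ ∈ Submodule.span k
      (wordProd k '' {l : List (Fin n ⊕ Fin m) | l ≠ [] ∧ ∀ x ∈ l, x ∉ U}) := by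
    refine Submodule.span_mono ?_ hφ
    rintro _ ⟨l, hl, -, rfl⟩
    exact ⟨_, ⟨by simpa using hl, by simp [hUdef]⟩, rfl⟩
  have hφ₁ : φ ∈ FreeAlgebra.wordSpan k (Fin n ⊕ Fin m) 1 :=
    Submodule.span_mono (Set.image_mono fun l hl => List.length_pos_iff.2 hl.1) hφ'
  have hU₁ : wordProd k U ∈ FreeAlgebra.wordSpan k (Fin n ⊕ Fin m) 1 :=
    FreeAlgebra.wordProd_mem_wordSpan (List.length_pos_iff.2 hU)
  refine ⟨?_, fun ε hε => ?_⟩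
  · have hker : FreeAlgebra.wordSpan k (Fin n ⊕ Fin m) 1 ≤
        LinearMap.ker (FreeAlgebra.lift k (fun _ => (0 : k))).toLinearMap := by
      rw [FreeAlgebra.wordSpan, Submodule.span_le]
      rintro _ ⟨l, hl, rfl⟩
      obtain ⟨x, t, rfl⟩ := List.exists_cons_of_ne_nil (List.length_pos_iff.1 hl)
      simp [FreeAlgebra.wordProd_cons]
    refine ⟨RingQuot.liftAlgHom k ⟨FreeAlgebra.lift k fun _ => 0, ?_⟩, fun i => ?_⟩
    · rintro a b ⟨rfl, rfl⟩
      exact (hker hU₁).trans (hker hφ₁).symm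
    · rw [RingQuot.liftAlgHom_mkAlgHom_apply, FreeAlgebra.lift_ι_apply]
  · rw [eq_bot_iff]
    intro y hy
    obtain ⟨f, rfl⟩ := RingQuot.mkAlgHom_surjective k _ y
    have hπ := RingQuot.mkAlgHom_rel k (s := fun a b => a = wordProd k U ∧ b = φ) ⟨rfl, rfl⟩
    have hf : FreeAlgebra.reduce U φ f = 0 := by
      refine FreeAlgebra.eq_zero_of_forall_mem_wordSpan fun i => ?_
      have hyi : RingQuot.mkAlgHom k _ f ∈ augIdeal ε ^ ((i + 1) * U.length) := by
        simp only [Submodule.mem_iInf] at hy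
        exact hy _ (Nat.mul_pos i.succ_pos (List.length_pos_iff.2 hU))
      obtain ⟨g, hg, hgf⟩ := augIdeal_pow_le _ (RingQuot.mkAlgHom_surjective k _) ε hε _ hyi
      rw [← RingQuot.map_eq_of_mkAlgHom_eq (FreeAlgebra.reduce U φ) ?_ hgf]
      · refine FreeAlgebra.reduce_mem_wordSpan hU hφ₁ i ?_
        refine Submodule.span_mono (Set.image_mono fun l hl => ?_) hg
        exact (Nat.mul_le_mul_right _ i.le_succ).trans hl
      · rintro a b ⟨rfl, rfl⟩ p q
        exact FreeAlgebra.reduce_mul_wordProd_mul hU hUdec hφ' p q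
    rw [Submodule.mem_bot, ← FreeAlgebra.map_reduce_eq _ hU hπ f, hf, map_zero]
end
end

section
/- In the free algebra F the following identities hold: r₃ = r₃y₂ + y₁r₃ − x₁r₂ + r₁x₁ and r₄ = r₄y₁ + y₂r₄ − x₂r₁ + r₂x₂. Consequently, in B = F/(r₁, r₂) the images of r₃ and r₄ lie in I(B)ⁿ for every n ≥ 1; that is, r₃ and r₄ belong to the ideal I^ω(B) = ⋂_{n≥1} I(B)ⁿ. -/
noncomputable section

variable (k : Type*) [CommRing k]

/-- The generators `x₁, x₂, y₁, y₂` of the free algebra `F` on four generators: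
`x₁ = Xg k 0`, `x₂ = Xg k 1`, `y₁ = Xg k 2`, `y₂ = Xg k 3`. -/
def Xg (i : Fin 4) : FreeAlgebra k (Fin 4) := FreeAlgebra.ι k i

/-- `r₁ = x₁x₂ + y₁² − y₁`. -/
def r1 : FreeAlgebra k (Fin 4) := Xg k 0 * Xg k 1 + Xg k 2 * Xg k 2 - Xg k 2
/-- `r₂ = x₂x₁ + y₂² − y₂`. -/
def r2 : FreeAlgebra k (Fin 4) := Xg k 1 * Xg k 0 + Xg k 3 * Xg k 3 - Xg k 3
/-- `r₃ = x₁y₂ − y₁x₁`. -/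
def r3 : FreeAlgebra k (Fin 4) := Xg k 0 * Xg k 3 - Xg k 2 * Xg k 0
/-- `r₄ = x₂y₁ − y₂x₂`. -/
def r4 : FreeAlgebra k (Fin 4) := Xg k 1 * Xg k 2 - Xg k 3 * Xg k 1

/-- The relations of `B = F/(r₁, r₂)`. -/
def relB : FreeAlgebra k (Fin 4) → FreeAlgebra k (Fin 4) → Prop := fun a b =>
  (a = r1 k ∨ a = r2 k) ∧ b = 0

/-- The relations of `A = F/(r₁, r₂, r₃, r₄)`. -/
def relA : FreeAlgebra k (Fin 4) → FreeAlgebra k (Fin 4) → Prop := fun a b =>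
  (a = r1 k ∨ a = r2 k ∨ a = r3 k ∨ a = r4 k) ∧ b = 0

/-- `B = F/(r₁, r₂)`. -/
def AlgB : Type _ := RingQuot (relB k)
/-- `A = F/(r₁, r₂, r₃, r₄)`. -/
def AlgA : Type _ := RingQuot (relA k)

instance : Ring (AlgB k) := by unfold AlgB; infer_instance
instance : Algebra k (AlgB k) := by unfold AlgB; infer_instance
instance : Ring (AlgA k) := by unfold AlgA; infer_instance
instance : Algebra k (AlgA k) := by unfold AlgA; infer_instance

/-- The projection `F → B`. -/
def mkB : FreeAlgebra k (Fin 4) →ₐ[k] AlgB k := RingQuot.mkAlgHom k (relB k)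
/-- The projection `F → A`. -/
def mkA : FreeAlgebra k (Fin 4) →ₐ[k] AlgA k := RingQuot.mkAlgHom k (relA k)

/-- The augmentation of `B`, sending every generator to `0`. -/
def εB : AlgB k →ₐ[k] k :=
  RingQuot.liftAlgHom k
    ⟨FreeAlgebra.lift k (fun _ => (0 : k)), by
      rintro a b ⟨h, rfl⟩
      rcases h with rfl | rfl <;> simp [r1, r2, Xg]⟩

/-- The augmentation of `A`, sending every generator to `0`. -/
def εA : AlgA k →ₐ[k] k :=
  RingQuot.liftAlgHom k
    ⟨FreeAlgebra.lift k (fun _ => (0 : k)), by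
      rintro a b ⟨h, rfl⟩
      rcases h with rfl | rfl | rfl | rfl <;> simp [r1, r2, r3, r4, Xg]⟩

/-- If `a, u, v` lie in `I` and `a = a v + u a`, then `a` lies in every positive power of `I`. -/
theorem mem_pow_of_eq_mul_add_mul {R A : Type*} [CommSemiring R] [Semiring A] [Algebra R A]
    {I : Submodule R A} {a u v : A} (ha : a ∈ I) (hu : u ∈ I) (hv : v ∈ I)
    (h : a = a * v + u * a) {n : ℕ} (hn : 1 ≤ n) : a ∈ I ^ n := by
  induction n, hn using Nat.le_induction with
  | base => simpa using ha
  | succ n hn ih =>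
    rw [h]
    refine add_mem ?_ ?_
    · rw [pow_succ]
      exact Submodule.mul_mem_mul ih hv
    · rw [pow_succ']
      exact Submodule.mul_mem_mul hu ih

theorem r3_eq :
    r3 k = r3 k * Xg k 3 + Xg k 2 * r3 k - Xg k 0 * r2 k + r1 k * Xg k 0 := by
  simp only [r1, r2, r3]
  noncomm_ring

theorem r4_eq :
    r4 k = r4 k * Xg k 2 + Xg k 3 * r4 k - Xg k 1 * r1 k + r2 k * Xg k 1 := by
  simp only [r1, r2, r4]
  noncomm_ring

theorem mkB_r1 : mkB k (r1 k) = 0 :=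
  (RingQuot.mkAlgHom_rel k (s := relB k) ⟨Or.inl rfl, rfl⟩).trans (map_zero (mkB k))

theorem mkB_r2 : mkB k (r2 k) = 0 :=
  (RingQuot.mkAlgHom_rel k (s := relB k) ⟨Or.inr rfl, rfl⟩).trans (map_zero (mkB k))

theorem εB_mkB (a : FreeAlgebra k (Fin 4)) :
    εB k (mkB k a) = FreeAlgebra.lift k (fun _ => (0 : k)) a :=
  RingQuot.liftAlgHom_mkAlgHom_apply k _ _ a

theorem mkB_mem_augIdeal {a : FreeAlgebra k (Fin 4)} :
    mkB k a ∈ augIdeal (εB k) ↔ FreeAlgebra.lift k (fun _ => (0 : k)) a = 0 := by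
  rw [← εB_mkB]
  rfl

/-- In `F` one has `r₃ = r₃y₂ + y₁r₃ − x₁r₂ + r₁x₁` and `r₄ = r₄y₁ + y₂r₄ − x₂r₁ + r₂x₂`;
consequently in `B = F/(r₁, r₂)` the images of `r₃` and `r₄` lie in `I(B)ⁿ` for all `n ≥ 1`,
i.e. they belong to `I^ω(B) = ⋂_{n≥1} I(B)ⁿ`. -/
theorem r3_r4_in_omega_power :
    (r3 k = r3 k * Xg k 3 + Xg k 2 * r3 k - Xg k 0 * r2 k + r1 k * Xg k 0)
    ∧ (r4 k = r4 k * Xg k 2 + Xg k 3 * r4 k - Xg k 1 * r1 k + r2 k * Xg k 1)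
    ∧ (∀ n : ℕ, 1 ≤ n →
        mkB k (r3 k) ∈ augIdeal (εB k) ^ n ∧ mkB k (r4 k) ∈ augIdeal (εB k) ^ n) := by
  refine ⟨r3_eq k, r4_eq k, fun n hn => ?_⟩
  have hX (i : Fin 4) : mkB k (Xg k i) ∈ augIdeal (εB k) := by
    simp [mkB_mem_augIdeal, Xg]
  constructor
  · refine mem_pow_of_eq_mul_add_mul ?_ (hX 2) (hX 3) ?_ hn
    · exact (mkB_mem_augIdeal k).2 (by simp [r3, Xg])
    · simpa [mkB_r1, mkB_r2] using congrArg (mkB k) (r3_eq k)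
  · refine mem_pow_of_eq_mul_add_mul ?_ (hX 3) (hX 2) ?_ hn
    · exact (mkB_mem_augIdeal k).2 (by simp [r4, Xg])
    · simpa [mkB_r1, mkB_r2] using congrArg (mkB k) (r4_eq k)
end
end

section
/- Let ℬ be the set of words in the free monoid on the four letters x₁, x₂, y₁, y₂ that contain none of x₁x₂, x₂x₁, x₁y₂, x₂y₁ as a contiguous subword. Then the family of images in A of the words of ℬ (each word mapped to the corresponding product of generators in A, the empty word mapping to 1) is a basis of A as a k-module. -/
noncomputable section

variable (k : Type*) [CommRing k]

/-- The element of `A` given by a word in the generators (the empty word giving `1`). -/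
def wordProdA (l : List (Fin 4)) : AlgA k := mkA k ((l.map (FreeAlgebra.ι k)).prod)

/-- A word (letters `0 = x₁`, `1 = x₂`, `2 = y₁`, `3 = y₂`) is good if it contains none of
`x₁x₂`, `x₂x₁`, `x₁y₂`, `x₂y₁` as a contiguous subword. -/
def GoodWord (l : List (Fin 4)) : Prop :=
  ¬ [0, 1] <:+: l ∧ ¬ [1, 0] <:+: l ∧ ¬ [0, 3] <:+: l ∧ ¬ [1, 2] <:+: l

theorem goodWord_nil : GoodWord [] := by simp [GoodWord]

theorem goodWord_cons (h : Fin 4) (t : List (Fin 4)) :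
    GoodWord (h :: t) ↔ GoodWord t ∧ ¬ (h = 0 ∧ [1] <+: t) ∧ ¬ (h = 1 ∧ [0] <+: t) ∧
      ¬ (h = 0 ∧ [3] <+: t) ∧ ¬ (h = 1 ∧ [2] <+: t) := by
  simp only [GoodWord, List.infix_cons_iff, List.cons_prefix_cons, eq_comm (b := h)]
  tauto

theorem mkA_eq_zero {r : FreeAlgebra k (Fin 4)}
    (h : r = r1 k ∨ r = r2 k ∨ r = r3 k ∨ r = r4 k) : mkA k r = 0 := by
  have := RingQuot.mkAlgHom_rel k (s := relA k) (x := r) (y := 0) ⟨h, rfl⟩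
  rw [map_zero] at this
  exact this

/-- `IsDual a b c d` says that the letters `a, b, c, d` are `x₁, x₂, y₁, y₂` or the letters
`x₂, x₁, y₂, y₁`: the relations of `A` are invariant under exchanging the indices `1, 2`. -/
def IsDual (a b c d : Fin 4) : Prop :=
  (a = 0 ∧ b = 1 ∧ c = 2 ∧ d = 3) ∨ (a = 1 ∧ b = 0 ∧ c = 3 ∧ d = 2)

theorem IsDual.symm {a b c d : Fin 4} (h : IsDual a b c d) : IsDual b a d c := by
  unfold IsDual at *; tauto

theorem IsDual.eq_or {a b c d : Fin 4} (hp : IsDual a b c d) (h : Fin 4) :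
    h = a ∨ h = b ∨ h = c ∨ h = d := by
  rcases hp with ⟨rfl, rfl, rfl, rfl⟩ | ⟨rfl, rfl, rfl, rfl⟩ <;> revert h <;> decide

theorem IsDual.goodWord_cons_x {a b c d : Fin 4} (hp : IsDual a b c d) (t : List (Fin 4)) :
    GoodWord (a :: t) ↔ GoodWord t ∧ ¬ [b] <+: t ∧ ¬ [d] <+: t := by
  rcases hp with ⟨rfl, rfl, rfl, rfl⟩ | ⟨rfl, rfl, rfl, rfl⟩ <;> simp [goodWord_cons]

theorem IsDual.goodWord_cons_y {a b c d : Fin 4} (hp : IsDual a b c d) (t : List (Fin 4)) :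
    GoodWord (c :: t) ↔ GoodWord t := by
  rcases hp with ⟨rfl, rfl, rfl, rfl⟩ | ⟨rfl, rfl, rfl, rfl⟩ <;> simp [goodWord_cons]

theorem IsDual.ne {a b c d : Fin 4} (hp : IsDual a b c d) :
    a ≠ b ∧ a ≠ c ∧ a ≠ d ∧ b ≠ c ∧ b ≠ d ∧ c ≠ d := by
  rcases hp with ⟨rfl, rfl, rfl, rfl⟩ | ⟨rfl, rfl, rfl, rfl⟩ <;> decide

section Span

theorem wordProdA_nil : wordProdA k [] = 1 := by simp [wordProdA]

theorem wordProdA_cons (h : Fin 4) (t : List (Fin 4)) :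
    wordProdA k (h :: t) = mkA k (Xg k h) * wordProdA k t := by
  simp [wordProdA, Xg]

theorem IsDual.mkA_x_mul_x {a b c d : Fin 4} (hp : IsDual a b c d) :
    mkA k (Xg k a) * mkA k (Xg k b) =
      mkA k (Xg k c) - mkA k (Xg k c) * mkA k (Xg k c) := by
  rw [← sub_eq_zero]
  rcases hp with ⟨rfl, rfl, rfl, rfl⟩ | ⟨rfl, rfl, rfl, rfl⟩
  · rw [← mkA_eq_zero k (.inl rfl)]; simp only [r1, map_add, map_sub, map_mul]; abel
  · rw [← mkA_eq_zero k (.inr (.inl rfl))]; simp only [r2, map_add, map_sub, map_mul]; abel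

theorem IsDual.mkA_x_mul_y {a b c d : Fin 4} (hp : IsDual a b c d) :
    mkA k (Xg k a) * mkA k (Xg k d) = mkA k (Xg k c) * mkA k (Xg k a) := by
  rw [← sub_eq_zero]
  rcases hp with ⟨rfl, rfl, rfl, rfl⟩ | ⟨rfl, rfl, rfl, rfl⟩
  · rw [← mkA_eq_zero k (.inr (.inr (.inl rfl)))]; simp only [r3, map_sub, map_mul]
  · rw [← mkA_eq_zero k (.inr (.inr (.inr rfl)))]; simp only [r4, map_sub, map_mul]

/-- The span of the good words in `A`. -/
def goodSpan : Submodule k (AlgA k) :=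
  Submodule.span k (Set.range (fun w : {l : List (Fin 4) // GoodWord l} => wordProdA k w.1))

variable {k} in
theorem wordProdA_mem_goodSpan {w : List (Fin 4)} (hw : GoodWord w) :
    wordProdA k w ∈ goodSpan k :=
  Submodule.subset_span ⟨⟨w, hw⟩, rfl⟩

variable {k} in
theorem mul_mem_goodSpan {z : AlgA k}
    (h : ∀ w, GoodWord w → z * wordProdA k w ∈ goodSpan k) {s : AlgA k}
    (hs : s ∈ goodSpan k) : z * s ∈ goodSpan k := by
  induction hs using Submodule.span_induction with
  | mem _ hx =>
    obtain ⟨w, rfl⟩ := hx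
    exact h w.1 w.2
  | zero => rw [mul_zero]; exact Submodule.zero_mem _
  | add x y _ _ hx hy => rw [mul_add]; exact Submodule.add_mem _ hx hy
  | smul r x _ hx => rw [mul_smul_comm]; exact Submodule.smul_mem _ r hx

theorem IsDual.y_mul_mem_goodSpan {a b c d : Fin 4} (hp : IsDual a b c d) {s : AlgA k}
    (hs : s ∈ goodSpan k) : mkA k (Xg k c) * s ∈ goodSpan k :=
  mul_mem_goodSpan (fun w hw => by
    rw [← wordProdA_cons]
    exact wordProdA_mem_goodSpan ((hp.goodWord_cons_y w).2 hw)) hs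

theorem IsDual.x_mul_wordProdA_mem_goodSpan {a b c d : Fin 4} (hp : IsDual a b c d)
    (w : List (Fin 4)) (hw : GoodWord w) : mkA k (Xg k a) * wordProdA k w ∈ goodSpan k := by
  obtain ⟨hab, hac, had, hbc, hbd, hcd⟩ := hp.ne
  induction w with
  | nil =>
    rw [← wordProdA_cons]
    exact wordProdA_mem_goodSpan ((hp.goodWord_cons_x []).2 (by simp [goodWord_nil]))
  | cons h t ih =>
    have ht : GoodWord t := ((goodWord_cons h t).1 hw).1
    have hmem := wordProdA_mem_goodSpan (k := k) ht
    rcases hp.eq_or h with rfl | rfl | rfl | rfl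
    · rw [← wordProdA_cons]
      exact wordProdA_mem_goodSpan ((hp.goodWord_cons_x _).2 (by simp_all [eq_comm]))
    · rw [wordProdA_cons, ← mul_assoc, hp.mkA_x_mul_x k, sub_mul, mul_assoc]
      exact Submodule.sub_mem _ (hp.y_mul_mem_goodSpan k hmem)
        (hp.y_mul_mem_goodSpan k (hp.y_mul_mem_goodSpan k hmem))
    · rw [← wordProdA_cons]
      exact wordProdA_mem_goodSpan ((hp.goodWord_cons_x _).2 (by simp_all [eq_comm]))
    · rw [wordProdA_cons, ← mul_assoc, hp.mkA_x_mul_y k, mul_assoc]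
      exact hp.y_mul_mem_goodSpan k (ih ht)

theorem mkA_mul_mem_goodSpan (f : FreeAlgebra k (Fin 4)) :
    ∀ s ∈ goodSpan k, mkA k f * s ∈ goodSpan k := by
  have hp : IsDual 0 1 2 3 := .inl ⟨rfl, rfl, rfl, rfl⟩
  induction f using FreeAlgebra.induction with
  | grade0 r =>
    intro s hs
    rw [AlgHom.commutes, ← Algebra.smul_def]
    exact Submodule.smul_mem _ _ hs
  | grade1 i =>
    intro s hs
    rcases hp.eq_or i with rfl | rfl | rfl | rfl
    · exact mul_mem_goodSpan (hp.x_mul_wordProdA_mem_goodSpan k) hs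
    · exact mul_mem_goodSpan (hp.symm.x_mul_wordProdA_mem_goodSpan k) hs
    · exact hp.y_mul_mem_goodSpan k hs
    · exact hp.symm.y_mul_mem_goodSpan k hs
  | mul f g hf hg =>
    intro s hs
    rw [map_mul, mul_assoc]
    exact hf _ (hg _ hs)
  | add f g hf hg =>
    intro s hs
    rw [map_add, add_mul]
    exact add_mem (hf _ hs) (hg _ hs)

theorem goodSpan_eq_top : goodSpan k = ⊤ := by
  refine eq_top_iff.2 fun z _ => ?_
  obtain ⟨f, rfl⟩ : ∃ f, mkA k f = z := RingQuot.mkAlgHom_surjective k (relA k) z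
  have := mkA_mul_mem_goodSpan k f _ (wordProdA_mem_goodSpan goodWord_nil)
  rwa [wordProdA_nil, mul_one] at this

end Span

section Action

open Classical in
/-- The linear extension of `f` from good words to the free module on all words, vanishing on the
words that are not good. -/
def extendGood (f : List (Fin 4) → List (Fin 4) →₀ k) :
    Module.End k (List (Fin 4) →₀ k) :=
  Finsupp.linearCombination k fun w => if GoodWord w then f w else 0

variable {k} in
theorem extendGood_single {f : List (Fin 4) → List (Fin 4) →₀ k} {w : List (Fin 4)}
    (hw : GoodWord w) : extendGood k f (Finsupp.single w 1) = f w := by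
  simp [extendGood, hw]

variable {k} in
theorem extendGood_single_of_not {f : List (Fin 4) → List (Fin 4) →₀ k} {w : List (Fin 4)}
    (hw : ¬ GoodWord w) : extendGood k f (Finsupp.single w 1) = 0 := by
  simp [extendGood, hw]

/-- Left multiplication by the letter `c`, one of `y₁, y₂`. -/
def yAct (c : Fin 4) : Module.End k (List (Fin 4) →₀ k) :=
  extendGood k fun w => Finsupp.single (c :: w) 1

/-- The normal form of the product of the letter `a` and a good word, for `IsDual a b c d`. -/
def xNormal (a b c d : Fin 4) : List (Fin 4) → List (Fin 4) →₀ k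
  | [] => Finsupp.single [a] 1
  | h :: t =>
    if h = b then Finsupp.single (c :: t) 1 - Finsupp.single (c :: c :: t) 1
    else if h = d then yAct k c (xNormal a b c d t)
    else Finsupp.single (a :: h :: t) 1

/-- Left multiplication by the letter `a`, one of `x₁, x₂`, for `IsDual a b c d`. -/
def xAct (a b c d : Fin 4) : Module.End k (List (Fin 4) →₀ k) :=
  extendGood k (xNormal k a b c d)

variable {k} in
theorem yAct_single {c : Fin 4} {w : List (Fin 4)} (hw : GoodWord w) :
    yAct k c (Finsupp.single w 1) = Finsupp.single (c :: w) 1 :=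
  extendGood_single hw

variable {k} in
theorem xAct_single {a b c d : Fin 4} {w : List (Fin 4)} (hw : GoodWord w) :
    xAct k a b c d (Finsupp.single w 1) = xNormal k a b c d w :=
  extendGood_single hw

variable {k} in
theorem IsDual.xNormal_eq_single {a b c d : Fin 4} (hp : IsDual a b c d) {t : List (Fin 4)}
    (ht : GoodWord (a :: t)) : xNormal k a b c d t = Finsupp.single (a :: t) 1 := by
  cases t with
  | nil => rfl
  | cons h t =>
    have := (hp.goodWord_cons_x _).1 ht
    simp only [List.cons_prefix_cons, List.nil_prefix, and_true] at this
    rw [xNormal, if_neg (Ne.symm this.2.1), if_neg (Ne.symm this.2.2)]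

theorem IsDual.xAct_mul_yAct {a b c d : Fin 4} (hp : IsDual a b c d) :
    xAct k a b c d * yAct k d = yAct k c * xAct k a b c d := by
  refine Finsupp.lhom_ext' fun w => LinearMap.ext_ring ?_
  simp only [LinearMap.comp_apply, Finsupp.lsingle_apply, Module.End.mul_apply]
  by_cases hw : GoodWord w
  · rw [yAct_single hw, xAct_single hw, xAct_single ((hp.symm.goodWord_cons_y w).2 hw), xNormal,
      if_neg hp.ne.2.2.2.2.1.symm, if_pos rfl]
  · simp only [xAct, yAct, extendGood_single_of_not hw, map_zero]

theorem IsDual.xAct_xAct_single {a b c d : Fin 4} (hp : IsDual a b c d) (w : List (Fin 4))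
    (hw : GoodWord w) :
    xAct k a b c d (xAct k b a d c (Finsupp.single w 1)) =
      Finsupp.single (c :: w) 1 - Finsupp.single (c :: c :: w) 1 := by
  obtain ⟨hab, hac, had, hbc, hbd, hcd⟩ := hp.ne
  by_cases hb : GoodWord (b :: w)
  · rw [xAct_single hw, hp.symm.xNormal_eq_single hb, xAct_single hb, xNormal, if_pos rfl]
  induction w with
  | nil => exact absurd ((hp.symm.goodWord_cons_x []).2 (by simp [goodWord_nil])) hb
  | cons h t ih =>
    have ht : GoodWord t := ((goodWord_cons h t).1 hw).1
    have hy {c' w} (h' : GoodWord w) := yAct_single (k := k) (c := c') h'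
    have gc := hp.goodWord_cons_y
    have gd := hp.symm.goodWord_cons_y
    have hha : h = a ∨ h = c := by
      rw [hp.symm.goodWord_cons_x] at hb
      simp only [hw, List.cons_prefix_cons, List.nil_prefix, and_true, true_and] at hb
      tauto
    rcases hha with rfl | rfl
    · rw [xAct_single hw, xNormal, if_pos rfl, map_sub,
        xAct_single ((gd _).2 ht), xAct_single ((gd _).2 ((gd _).2 ht)),
        xNormal, if_neg hbd.symm, if_pos rfl, xNormal, if_neg hbd.symm, if_pos rfl,
        xNormal, if_neg hbd.symm, if_pos rfl, hp.xNormal_eq_single hw, hy hw, hy ((gc _).2 hw)]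
    · have key : xAct k a b h d (xAct k b a d h (Finsupp.single t 1)) =
          Finsupp.single (h :: t) 1 - Finsupp.single (h :: h :: t) 1 := by
        by_cases hbt : GoodWord (b :: t)
        · rw [xAct_single ht, hp.symm.xNormal_eq_single hbt, xAct_single hbt, xNormal, if_pos rfl]
        · exact ih ht hbt
      have comm := LinearMap.congr_fun (hp.xAct_mul_yAct k) (xAct k b a d h (Finsupp.single t 1))
      have comm' := LinearMap.congr_fun (hp.symm.xAct_mul_yAct k) (Finsupp.single t 1)
      simp only [Module.End.mul_apply] at comm comm'
      rw [← yAct_single (k := k) ht, comm', comm, key, map_sub, hy hw, hy ((gc _).2 hw)]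

theorem IsDual.xAct_mul_xAct_add {a b c d : Fin 4} (hp : IsDual a b c d) :
    xAct k a b c d * xAct k b a d c + yAct k c * yAct k c = yAct k c := by
  refine Finsupp.lhom_ext' fun w => LinearMap.ext_ring ?_
  simp only [LinearMap.comp_apply, Finsupp.lsingle_apply, Module.End.mul_apply,
    LinearMap.add_apply]
  by_cases hw : GoodWord w
  · rw [hp.xAct_xAct_single k w hw, yAct_single hw, yAct_single ((hp.goodWord_cons_y w).2 hw),
      sub_add_cancel]
  · simp only [xAct, yAct, extendGood_single_of_not hw, map_zero, add_zero]

/-- The action of the generators of `A` on the free module on all words. -/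
def genAct : Fin 4 → Module.End k (List (Fin 4) →₀ k) :=
  ![xAct k 0 1 2 3, xAct k 1 0 3 2, yAct k 2, yAct k 3]

/-- The action of `A` on the free module on all words, through normal forms. -/
def actA : AlgA k →ₐ[k] Module.End k (List (Fin 4) →₀ k) :=
  RingQuot.liftAlgHom k
    ⟨FreeAlgebra.lift k (genAct k), by
      have hp : IsDual 0 1 2 3 := .inl ⟨rfl, rfl, rfl, rfl⟩
      rintro a b ⟨h, rfl⟩
      rcases h with rfl | rfl | rfl | rfl
      · simp [r1, Xg, genAct, hp.xAct_mul_xAct_add k]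
      · simp [r2, Xg, genAct, hp.symm.xAct_mul_xAct_add k]
      · simp [r3, Xg, genAct, hp.xAct_mul_yAct k]
      · simp [r4, Xg, genAct, hp.symm.xAct_mul_yAct k]⟩

theorem actA_mkA_Xg (i : Fin 4) : actA k (mkA k (Xg k i)) = genAct k i := by
  have : actA k (mkA k (Xg k i)) = FreeAlgebra.lift k (genAct k) (Xg k i) :=
    RingQuot.liftAlgHom_mkAlgHom_apply k _ _ _
  rw [this, Xg, FreeAlgebra.lift_ι_apply]

theorem actA_wordProdA (w : List (Fin 4)) (hw : GoodWord w) :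
    actA k (wordProdA k w) (Finsupp.single [] 1) = Finsupp.single w 1 := by
  have hp : IsDual 0 1 2 3 := .inl ⟨rfl, rfl, rfl, rfl⟩
  induction w with
  | nil => simp [wordProdA_nil]
  | cons h t ih =>
    have ht : GoodWord t := ((goodWord_cons h t).1 hw).1
    rw [wordProdA_cons, map_mul, Module.End.mul_apply, ih ht, actA_mkA_Xg]
    rcases hp.eq_or h with rfl | rfl | rfl | rfl
    · exact (xAct_single ht).trans (hp.xNormal_eq_single hw)
    · exact (xAct_single ht).trans (hp.symm.xNormal_eq_single hw)
    · exact yAct_single ht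
    · exact yAct_single ht

end Action

/-- The images in `A` of the words containing none of `x₁x₂`, `x₂x₁`, `x₁y₂`, `x₂y₁` as a
contiguous subword form a basis of `A` as a `k`-module. -/
theorem goodWords_basis :
    LinearIndependent k (fun w : {l : List (Fin 4) // GoodWord l} => wordProdA k w.1)
    ∧ Submodule.span k
        (Set.range (fun w : {l : List (Fin 4) // GoodWord l} => wordProdA k w.1)) = ⊤ := by
  refine ⟨?_, goodSpan_eq_top k⟩
  refine LinearIndependent.of_comp
    ((LinearMap.applyₗ (Finsupp.single [] 1)).comp (actA k).toLinearMap) ?_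
  have h := (Finsupp.linearIndependent_single_one k (List (Fin 4))).comp
    (Subtype.val : {l : List (Fin 4) // GoodWord l} → _) Subtype.val_injective
  convert h using 1
  funext w
  exact actA_wordProdA k w.1 w.2
end
end
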